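/- arXiv:2510.10979 — 2 statements merged into one kernel-verified Lean document; each statement's English description precedes it below -/
import Mathlib

section
/- Let g ∈ ℝ, let φ, θ, ψ ∈ ℝ, and let (q_w, q_x, q_y, q_z) be the quaternion obtained from the Z-Y-X Euler angles (φ, θ, ψ) by the half-angle conversion formulas. Then det A₁(q, g) = −16 g³ · cos θ · sin ψ. -/
/-- The 4×4 matrix A₁(q, g) built from rows {1,2,3,4} of the observability matrix. -/
def A1 (qw qx qy qz g : ℝ) : Matrix (Fin 4) (Fin 4) ℝ :=
  !![-2*g*qy, 2*g*qz, -2*g*qw, 2*g*qx;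
     2*g*qx, 2*g*qw, 2*g*qz, 2*g*qy;
     2*g*qw, -2*g*qx, -2*g*qy, 2*g*qz;
     2*qw - qy, 2*qx + qz, -2*qy - qw, -2*qz + qx]

open Real in
/-- Scalar part of the quaternion obtained from Z-Y-X Euler angles (roll φ, pitch θ, heading ψ). -/
noncomputable def eulerQw (φ θ ψ : ℝ) : ℝ :=
  cos (φ / 2) * cos (θ / 2) * cos (ψ / 2) + sin (φ / 2) * sin (θ / 2) * sin (ψ / 2)

open Real in
/-- i-part of the quaternion obtained from Z-Y-X Euler angles. -/
noncomputable def eulerQx (φ θ ψ : ℝ) : ℝ :=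
  sin (φ / 2) * cos (θ / 2) * cos (ψ / 2) - cos (φ / 2) * sin (θ / 2) * sin (ψ / 2)

open Real in
/-- j-part of the quaternion obtained from Z-Y-X Euler angles. -/
noncomputable def eulerQy (φ θ ψ : ℝ) : ℝ :=
  cos (φ / 2) * sin (θ / 2) * cos (ψ / 2) + sin (φ / 2) * cos (θ / 2) * sin (ψ / 2)

open Real in
/-- k-part of the quaternion obtained from Z-Y-X Euler angles. -/
noncomputable def eulerQz (φ θ ψ : ℝ) : ℝ :=
  cos (φ / 2) * cos (θ / 2) * sin (ψ / 2) - sin (φ / 2) * sin (θ / 2) * cos (ψ / 2)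

theorem det_A1 (qw qx qy qz g : ℝ) :
    (A1 qw qx qy qz g).det =
      -32 * g ^ 3 * (qw ^ 2 + qx ^ 2 + qy ^ 2 + qz ^ 2) * (qw * qz + qx * qy) := by
  simp [A1, Matrix.det_succ_row_zero, Fin.sum_univ_succ, Fin.succAbove]
  ring

open Real in
theorem euler_normSq (φ θ ψ : ℝ) :
    eulerQw φ θ ψ ^ 2 + eulerQx φ θ ψ ^ 2 + eulerQy φ θ ψ ^ 2 + eulerQz φ θ ψ ^ 2 = 1 := by
  calc
    _ = (sin (φ / 2) ^ 2 + cos (φ / 2) ^ 2) * (sin (θ / 2) ^ 2 + cos (θ / 2) ^ 2) *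
        (sin (ψ / 2) ^ 2 + cos (ψ / 2) ^ 2) := by
      simp only [eulerQw, eulerQx, eulerQy, eulerQz]
      ring
    _ = 1 := by simp only [sin_sq_add_cos_sq, mul_one]

open Real in
theorem two_mul_euler_mul_add_mul (φ θ ψ : ℝ) :
    2 * (eulerQw φ θ ψ * eulerQz φ θ ψ + eulerQx φ θ ψ * eulerQy φ θ ψ) = cos θ * sin ψ := by
  calc
    _ = (sin (φ / 2) ^ 2 + cos (φ / 2) ^ 2) * (cos (θ / 2) ^ 2 - sin (θ / 2) ^ 2) *
        (2 * sin (ψ / 2) * cos (ψ / 2)) := by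
      simp only [eulerQw, eulerQx, eulerQy, eulerQz]
      ring
    _ = cos θ * sin ψ := by
      rw [sin_sq_add_cos_sq, one_mul, ← cos_two_mul', ← sin_two_mul, mul_div_cancel₀ θ two_ne_zero,
        mul_div_cancel₀ ψ two_ne_zero]

/-- For the Z-Y-X Euler-angle quaternion, `det A₁(q, g) = −16 g³ cos θ sin ψ`. -/
theorem det_A1_euler (g φ θ ψ : ℝ) :
    (A1 (eulerQw φ θ ψ) (eulerQx φ θ ψ) (eulerQy φ θ ψ) (eulerQz φ θ ψ) g).det
      = -16 * g^3 * Real.cos θ * Real.sin ψ := by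
  rw [det_A1, euler_normSq]
  linear_combination -16 * g ^ 3 * two_mul_euler_mul_add_mul φ θ ψ
end

section
/- Let g ∈ ℝ, let φ, θ, ψ ∈ ℝ, and let (q_w, q_x, q_y, q_z) be the quaternion obtained from the Z-Y-X Euler angles (φ, θ, ψ) by the half-angle conversion formulas. Then det A₂(q, g) = −16 g³ ( cos φ · cos ψ + sin θ · sin φ · sin ψ ). -/
/-- The 4×4 matrix A₂(q, g) built from rows {1,2,3,5} of the observability matrix. -/
def A2 (qw qx qy qz g : ℝ) : Matrix (Fin 4) (Fin 4) ℝ :=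
  !![-2*g*qy, 2*g*qz, -2*g*qw, 2*g*qx;
     2*g*qx, 2*g*qw, 2*g*qz, 2*g*qy;
     2*g*qw, -2*g*qx, -2*g*qy, 2*g*qz;
     -2*qz + qx, 2*qy + qw, 2*qx + qz, -2*qw + qy]

theorem det_A2 (qw qx qy qz g : ℝ) :
    (A2 qw qx qy qz g).det
      = -16 * g^3 * ((qw^2 + qx^2 + qy^2 + qz^2) * (qw^2 - qx^2 + qy^2 - qz^2)) := by
  simp [A2, Matrix.det_succ_row_zero, Fin.sum_univ_succ, Fin.succAbove]
  ring

open Real in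
/-- The middle diagonal entry of the rotation matrix of the Euler-angle quaternion. -/
theorem euler_rotation_yy (φ θ ψ : ℝ) :
    eulerQw φ θ ψ ^ 2 - eulerQx φ θ ψ ^ 2 + eulerQy φ θ ψ ^ 2 - eulerQz φ θ ψ ^ 2
      = cos φ * cos ψ + sin θ * sin φ * sin ψ := by
  have hc (x : ℝ) : cos x = cos (x / 2) ^ 2 - sin (x / 2) ^ 2 := by
    rw [← cos_two_mul', mul_div_cancel₀ x two_ne_zero]
  have hs (x : ℝ) : sin x = 2 * sin (x / 2) * cos (x / 2) := by
    rw [← sin_two_mul, mul_div_cancel₀ x two_ne_zero]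
  rw [hc φ, hc ψ, hs θ, hs φ, hs ψ]
  simp only [eulerQw, eulerQx, eulerQy, eulerQz]
  linear_combination (cos (φ / 2) ^ 2 - sin (φ / 2) ^ 2) *
    (cos (ψ / 2) ^ 2 - sin (ψ / 2) ^ 2) * sin_sq_add_cos_sq (θ / 2)

/-- For the Z-Y-X Euler-angle quaternion,
`det A₂(q, g) = −16 g³ (cos φ cos ψ + sin θ sin φ sin ψ)`. -/
theorem det_A2_euler (g φ θ ψ : ℝ) :
    (A2 (eulerQw φ θ ψ) (eulerQx φ θ ψ) (eulerQy φ θ ψ) (eulerQz φ θ ψ) g).det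
      = -16 * g^3 * (Real.cos φ * Real.cos ψ + Real.sin θ * Real.sin φ * Real.sin ψ) := by
  rw [det_A2, euler_normSq, euler_rotation_yy, one_mul]
end
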